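/- arXiv:2210.07456 — 5 statements merged into one kernel-verified Lean document; each statement's English description precedes it below -/
import Mathlib

section
/- Let M₁ be an a×m real row-stochastic matrix and M₂ an m×b real row-stochastic matrix (all entries nonnegative, each row summing to 1). Then ψ(M₁M₂) ≤ ζ(M₁) · ψ(M₂), where for a row-stochastic matrix M, ζ(M) := max over row indices i,k of (1 − Σ_j min(M_{ij}, M_{kj})) and ψ(M) := max over row indices i,k and column indices j of |M_{ij} − M_{kj}|. -/
/-- A real matrix is row-stochastic if all entries are nonnegative and each row sums to 1. -/
def RowStochastic {a b : ℕ} (M : Matrix (Fin a) (Fin b) ℝ) : Prop :=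
  (∀ i j, 0 ≤ M i j) ∧ ∀ i, ∑ j, M i j = 1

/-- `ζ(M) = max_{i,k} (1 − Σ_j min(M_{ij}, M_{kj}))`. -/
noncomputable def zeta {a b : ℕ} (M : Matrix (Fin a) (Fin b) ℝ) : ℝ :=
  ⨆ i, ⨆ k, (1 - ∑ j, min (M i j) (M k j))

/-- `ψ(M) = max_{i,k} max_j |M_{ij} − M_{kj}|`. -/
noncomputable def psi {a b : ℕ} (M : Matrix (Fin a) (Fin b) ℝ) : ℝ :=
  ⨆ i, ⨆ k, ⨆ j, |M i j - M k j|

theorem psi_entry_le {a b : ℕ} (M : Matrix (Fin a) (Fin b) ℝ) (i k : Fin a) (j : Fin b) :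
    |M i j - M k j| ≤ psi M := by
  unfold psi
  refine le_trans ?_ (le_ciSup (f := fun i => ⨆ k, ⨆ j, |M i j - M k j|)
    (Set.finite_range _).bddAbove i)
  refine le_trans ?_ (le_ciSup (f := fun k => ⨆ j, |M i j - M k j|)
    (Set.finite_range _).bddAbove k)
  exact le_ciSup (f := fun j => |M i j - M k j|) (Set.finite_range _).bddAbove j

theorem zeta_entry_le {a b : ℕ} (M : Matrix (Fin a) (Fin b) ℝ) (i k : Fin a) :
    1 - ∑ j, min (M i j) (M k j) ≤ zeta M := by
  unfold zeta
  refine le_trans ?_ (le_ciSup (f := fun i => ⨆ k, (1 - ∑ j, min (M i j) (M k j)))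
    (Set.finite_range _).bddAbove i)
  exact le_ciSup (f := fun k => (1 - ∑ j, min (M i j) (M k j))) (Set.finite_range _).bddAbove k

theorem hajnal_aux {m : ℕ} (p q v : Fin m → ℝ) (hp : ∑ j, p j = 1) (hq : ∑ j, q j = 1)
    (A B : ℝ) (hA : ∀ j, v j ≤ A) (hB : ∀ j, B ≤ v j) :
    ∑ j, p j * v j - ∑ j, q j * v j ≤ (1 - ∑ j, min (p j) (q j)) * (A - B) := by
  have h1 : ∑ j, (p j - min (p j) (q j)) * v j ≤ ∑ j, (p j - min (p j) (q j)) * A :=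
    Finset.sum_le_sum fun j _ =>
      mul_le_mul_of_nonneg_left (hA j) (sub_nonneg.2 (min_le_left _ _))
  have h2 : ∑ j, (q j - min (p j) (q j)) * B ≤ ∑ j, (q j - min (p j) (q j)) * v j :=
    Finset.sum_le_sum fun j _ =>
      mul_le_mul_of_nonneg_left (hB j) (sub_nonneg.2 (min_le_right _ _))
  rw [← Finset.sum_mul, Finset.sum_sub_distrib, hp] at h1
  rw [← Finset.sum_mul, Finset.sum_sub_distrib, hq] at h2
  simp only [sub_mul, Finset.sum_sub_distrib] at h1 h2 ⊢
  linarith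

/-- Hajnal's lemma: for row-stochastic matrices, `ψ(M₁M₂) ≤ ζ(M₁) ψ(M₂)`. -/
theorem hajnal_lemma {a m b : ℕ} [NeZero a] [NeZero m] [NeZero b]
    (M₁ : Matrix (Fin a) (Fin m) ℝ) (M₂ : Matrix (Fin m) (Fin b) ℝ)
    (h₁ : RowStochastic M₁) (h₂ : RowStochastic M₂) :
    psi (M₁ * M₂) ≤ zeta M₁ * psi M₂ := by
  have hψ : 0 ≤ psi M₂ := (abs_nonneg _).trans (psi_entry_le M₂ 0 0 0)
  have key : ∀ i k j, (M₁ * M₂) i j - (M₁ * M₂) k j ≤ zeta M₁ * psi M₂ := by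
    intro i k j
    obtain ⟨u, hu⟩ := Finite.exists_max (fun l => M₂ l j)
    obtain ⟨w, hw⟩ := Finite.exists_min (fun l => M₂ l j)
    have h := hajnal_aux (M₁ i) (M₁ k) (fun l => M₂ l j) (h₁.2 i) (h₁.2 k) _ _ hu hw
    have h3 : M₂ u j - M₂ w j ≤ psi M₂ := (le_abs_self _).trans (psi_entry_le M₂ u w j)
    have h4 : 0 ≤ 1 - ∑ l, min (M₁ i l) (M₁ k l) := by
      rw [← h₁.2 i, sub_nonneg]
      exact Finset.sum_le_sum fun l _ => min_le_left _ _
    rw [Matrix.mul_apply, Matrix.mul_apply]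
    exact h.trans ((mul_le_mul_of_nonneg_left h3 h4).trans
      (mul_le_mul_of_nonneg_right (zeta_entry_le M₁ i k) hψ))
  refine ciSup_le fun i => ciSup_le fun k => ciSup_le fun j => ?_
  exact abs_sub_le_iff.2 ⟨key i k j, key k i j⟩
end

section
/- Let K ≥ 2, let Π be a nonempty finite index set, let P be a K×K real matrix with all entries strictly positive, and let f : {1,…,K} × Π → ℝ be nonnegative with f_{lπ} > 0 for at least one pair (l, π). Define Q_{ij} := (Σ_{π∈Π} P_{ij} f_{jπ}) / (Σ_{l=1}^{K} Σ_{π∈Π} P_{il} f_{lπ}). Then for all row indices i, k and every column index j: |Q_{ij} − Q_{kj}| ≤ max_{l ≠ j} |P_{ij} P_{kl} − P_{il} P_{kj}| / (P_{ij} P_{kl} + P_{il} P_{kj}). -/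
/-- Central inequality in the proof of Lemma 3: for the conditional transition matrix
`Q_{ij} = (Σ_π P_{ij} f_{jπ}) / (Σ_l Σ_π P_{il} f_{lπ})`, the rows of `Q` differ by at most
`max_{l ≠ j} |P_{ij}P_{kl} − P_{il}P_{kj}| / (P_{ij}P_{kl} + P_{il}P_{kj})` in each column `j`. -/
theorem row_diff_of_conditional_transition {K : ℕ} (hK : 2 ≤ K)
    {ι : Type*} [Fintype ι] [Nonempty ι]
    (P : Matrix (Fin K) (Fin K) ℝ) (hP : ∀ i j, 0 < P i j)
    (f : Fin K → ι → ℝ) (hf : ∀ l π, 0 ≤ f l π) (hf' : ∃ l π, 0 < f l π)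
    (Q : Matrix (Fin K) (Fin K) ℝ)
    (hQ : ∀ i j, Q i j = (∑ π, P i j * f j π) / (∑ l, ∑ π, P i l * f l π)) :
    ∀ i k j, |Q i j - Q k j| ≤
      ⨆ l : {l : Fin K // l ≠ j},
        |P i j * P k l.1 - P i l.1 * P k j| / (P i j * P k l.1 + P i l.1 * P k j) := by
  intro i k j
  set M := ⨆ l : {l : Fin K // l ≠ j},
        |P i j * P k l.1 - P i l.1 * P k j| / (P i j * P k l.1 + P i l.1 * P k j) with hM
  have hM0 : 0 ≤ M := Real.iSup_nonneg fun l =>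
    div_nonneg (abs_nonneg _) (add_pos (mul_pos (hP _ _) (hP _ _)) (mul_pos (hP _ _) (hP _ _))).le
  have hMl : ∀ l, l ≠ j →
      |P i j * P k l - P i l * P k j| ≤ M * (P i j * P k l + P i l * P k j) := by
    intro l hl
    have h := le_ciSup (f := fun l : {l : Fin K // l ≠ j} =>
        |P i j * P k l.1 - P i l.1 * P k j| / (P i j * P k l.1 + P i l.1 * P k j))
        (Set.finite_range _).bddAbove ⟨l, hl⟩
    exact (div_le_iff₀ (add_pos (mul_pos (hP _ _) (hP _ _)) (mul_pos (hP _ _) (hP _ _)))).1 h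
  clear_value M
  obtain ⟨g, hg⟩ : ∃ g : Fin K → ℝ, ∀ l, g l = ∑ π, f l π := ⟨_, fun _ => rfl⟩
  have hg0 : ∀ l, 0 ≤ g l := fun l => by
    rw [hg]; exact Finset.sum_nonneg fun π _ => hf l π
  have hgp : ∃ l, 0 < g l := by
    obtain ⟨l, π, h⟩ := hf'
    refine ⟨l, ?_⟩
    rw [hg]
    exact Finset.sum_pos' (fun π _ => hf l π) ⟨π, Finset.mem_univ _, h⟩
  have hpos : ∀ i, 0 < ∑ l, P i l * g l := fun i => by
    obtain ⟨l, h⟩ := hgp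
    exact Finset.sum_pos' (fun l _ => mul_nonneg (hP _ _).le (hg0 l))
      ⟨l, Finset.mem_univ _, mul_pos (hP _ _) h⟩
  have hsplit : ∀ i, ∑ l, P i l * g l
      = P i j * g j + ∑ l ∈ Finset.univ.erase j, P i l * g l := fun i =>
    (Finset.add_sum_erase _ _ (Finset.mem_univ j)).symm
  have hA' : ∀ i, 0 ≤ ∑ l ∈ Finset.univ.erase j, P i l * g l := fun i =>
    Finset.sum_nonneg fun l _ => mul_nonneg (hP _ _).le (hg0 l)
  have hQ' : ∀ i, Q i j = P i j * g j / ∑ l, P i l * g l := fun i => by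
    rw [hQ]; simp only [← Finset.mul_sum, ← hg]
  have hdiff : |P i j * (∑ l ∈ Finset.univ.erase j, P k l * g l)
        - P k j * (∑ l ∈ Finset.univ.erase j, P i l * g l)|
      ≤ M * (P i j * (∑ l ∈ Finset.univ.erase j, P k l * g l)
        + P k j * (∑ l ∈ Finset.univ.erase j, P i l * g l)) := by
    simp only [Finset.mul_sum, ← Finset.sum_sub_distrib, ← Finset.sum_add_distrib]
    refine (Finset.abs_sum_le_sum_abs _ _).trans (Finset.sum_le_sum fun l hl => ?_)
    have h := mul_le_mul_of_nonneg_right (hMl l (Finset.ne_of_mem_erase hl)) (hg0 l)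
    calc _ = |(P i j * P k l - P i l * P k j) * g l| := by congr 1; ring
      _ = |P i j * P k l - P i l * P k j| * g l := by rw [abs_mul, abs_of_nonneg (hg0 l)]
      _ ≤ _ := h
      _ = _ := by ring
  have hi := hpos i
  have hk := hpos k
  rw [hQ', hQ', div_sub_div _ _ hi.ne' hk.ne', abs_div, abs_of_pos (mul_pos hi hk),
    div_le_iff₀ (mul_pos hi hk), hsplit i, hsplit k]
  have hAi := hA' i
  have hAk := hA' k
  generalize (∑ l ∈ Finset.univ.erase j, P i l * g l) = A at *
  generalize (∑ l ∈ Finset.univ.erase j, P k l * g l) = B at *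
  have h := mul_le_mul_of_nonneg_right hdiff (hg0 j)
  have ha := mul_nonneg (hP i j).le (hg0 j)
  have hb := mul_nonneg (hP k j).le (hg0 j)
  calc _ = |(P i j * B - P k j * A) * g j| := by congr 1; ring
    _ = |P i j * B - P k j * A| * g j := by rw [abs_mul, abs_of_nonneg (hg0 j)]
    _ ≤ _ := h
    _ = M * (P i j * g j * B + A * (P k j * g j)) := by ring
    _ ≤ _ := by
      refine mul_le_mul_of_nonneg_left ?_ hM0
      have h1 := mul_nonneg ha hb
      have h2 := mul_nonneg hAi hAk
      linarith [add_mul (P i j * g j) A (P k j * g j + B),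
        mul_add (P i j * g j) (P k j * g j) B, mul_add A (P k j * g j) B]
end

section
/- Let K ≥ 2, let Π be a nonempty finite index set, let P be a K×K real matrix with all entries strictly positive, and let f : {1,…,K} × Π → ℝ be nonnegative with f_{lπ} > 0 for at least one pair (l, π). Define Q_{ij} := (Σ_{π∈Π} P_{ij} f_{jπ}) / (Σ_{l=1}^{K} Σ_{π∈Π} P_{il} f_{lπ}). Then Q is row-stochastic, and ζ(Q) ≤ Ξ(P), where ζ(Q) := max_{i,k} (1 − Σ_j min(Q_{ij}, Q_{kj})) and Ξ(P) := max_{i,k} Σ_{j=1}^{K} max_{l ≠ j} |P_{ij} P_{kl} − P_{il} P_{kj}| / (P_{ij} P_{kl} + P_{il} P_{kj}). -/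
/-- `Ξ(P) = max_{i,k} Σ_j max_{l≠j} |P_{ij}P_{kl} − P_{il}P_{kj}|/(P_{ij}P_{kl} + P_{il}P_{kj})`. -/
noncomputable def Xi {K : ℕ} (P : Matrix (Fin K) (Fin K) ℝ) : ℝ :=
  ⨆ i, ⨆ k, ∑ j, ⨆ l : {l : Fin K // l ≠ j},
    |P i j * P k l.1 - P i l.1 * P k j| / (P i j * P k l.1 + P i l.1 * P k j)

/-- The conditional transition matrix `Q_{ij} = (Σ_π P_{ij} f_{jπ}) / (Σ_l Σ_π P_{il} f_{lπ})`
is row-stochastic and satisfies `ζ(Q) ≤ Ξ(P)`. -/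
theorem conditional_transition_rowStochastic_and_zeta_le_Xi {K : ℕ} (hK : 2 ≤ K)
    {ι : Type*} [Fintype ι] [Nonempty ι]
    (P : Matrix (Fin K) (Fin K) ℝ) (hP : ∀ i j, 0 < P i j)
    (f : Fin K → ι → ℝ) (hf : ∀ l π, 0 ≤ f l π) (hf' : ∃ l π, 0 < f l π)
    (Q : Matrix (Fin K) (Fin K) ℝ)
    (hQ : ∀ i j, Q i j = (∑ π, P i j * f j π) / (∑ l, ∑ π, P i l * f l π)) :
    RowStochastic Q ∧ zeta Q ≤ Xi P := by
  have hg : ∀ j, 0 ≤ ∑ π, f j π := fun j => Finset.sum_nonneg fun π _ => hf j π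
  have hS : ∀ i, 0 < ∑ l, ∑ π, P i l * f l π := by
    intro i
    obtain ⟨l, π, h⟩ := hf'
    have h0 : ∀ l π, 0 ≤ P i l * f l π := fun l π => mul_nonneg (hP i l).le (hf l π)
    refine Finset.sum_pos' (fun l _ => Finset.sum_nonneg fun π _ => h0 l π)
      ⟨l, Finset.mem_univ _, ?_⟩
    exact Finset.sum_pos' (fun π _ => h0 l π) ⟨π, Finset.mem_univ _, mul_pos (hP i l) h⟩
  have hnn : ∀ i j, 0 ≤ Q i j := by
    intro i j
    rw [hQ]
    exact div_nonneg (Finset.sum_nonneg fun π _ => mul_nonneg (hP i j).le (hf j π)) (hS i).le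
  have hsum : ∀ i, ∑ j, Q i j = 1 := by
    intro i
    simp only [hQ]
    rw [← Finset.sum_div]
    exact div_self (hS i).ne'
  refine ⟨⟨hnn, hsum⟩, ?_⟩
  have hle1 : ∀ i j, Q i j ≤ 1 := by
    intro i j
    rw [← hsum i]
    exact Finset.single_le_sum (fun l _ => hnn i l) (Finset.mem_univ j)
  have : Nonempty (Fin K) := ⟨⟨0, by omega⟩⟩
  unfold zeta Xi
  refine ciSup_le fun i => ciSup_le fun k => ?_
  refine le_trans ?_ (le_ciSup (Set.finite_range _).bddAbove i)
  refine le_trans ?_ (le_ciSup (Set.finite_range _).bddAbove k)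
  rw [← hsum i, ← Finset.sum_sub_distrib]
  refine Finset.sum_le_sum fun j _ => ?_
  set m := ⨆ l : {l : Fin K // l ≠ j},
    |P i j * P k l.1 - P i l.1 * P k j| / (P i j * P k l.1 + P i l.1 * P k j) with hm
  have hpos : ∀ l, 0 < P i j * P k l + P i l * P k j := fun l =>
    add_pos (mul_pos (hP _ _) (hP _ _)) (mul_pos (hP _ _) (hP _ _))
  have hm0 : 0 ≤ m := Real.iSup_nonneg fun l => div_nonneg (abs_nonneg _) (hpos _).le
  have key : ∀ l ∈ Finset.univ.erase j, Q i j * Q k l - Q i l * Q k j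
      ≤ m * (Q i j * Q k l + Q i l * Q k j) := by
    intro l hl
    have hlj : l ≠ j := Finset.ne_of_mem_erase hl
    have h1 : |P i j * P k l - P i l * P k j| / (P i j * P k l + P i l * P k j) ≤ m :=
      le_ciSup (f := fun l : {l : Fin K // l ≠ j} =>
        |P i j * P k l.1 - P i l.1 * P k j| / (P i j * P k l.1 + P i l.1 * P k j))
        (Set.finite_range _).bddAbove ⟨l, hlj⟩
    rw [div_le_iff₀ (hpos l)] at h1
    have h2 := (le_abs_self _).trans h1
    have hc : 0 ≤ (∑ π, f j π) * (∑ π, f l π) /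
        ((∑ l, ∑ π, P i l * f l π) * (∑ l, ∑ π, P k l * f l π)) :=
      div_nonneg (mul_nonneg (hg j) (hg l)) (mul_pos (hS i) (hS k)).le
    have h3 := mul_le_mul_of_nonneg_left h2 hc
    have e : ∀ a b, Q a b = P a b * (∑ π, f b π) / (∑ l, ∑ π, P a l * f l π) := by
      intro a b
      rw [hQ, Finset.mul_sum]
    rw [e i j, e k l, e i l, e k j]
    clear_value m
    generalize (∑ l, ∑ π, P i l * f l π) = A at h3 ⊢
    generalize (∑ l, ∑ π, P k l * f l π) = B at h3 ⊢
    generalize (∑ π, f j π) = u at h3 ⊢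
    generalize (∑ π, f l π) = v at h3 ⊢
    have e1 : P i j * u / A * (P k l * v / B) - P i l * v / A * (P k j * u / B)
        = u * v / (A * B) * (P i j * P k l - P i l * P k j) := by
      simp only [div_eq_mul_inv, mul_inv]
      ring
    have e2 : m * (P i j * u / A * (P k l * v / B) + P i l * v / A * (P k j * u / B))
        = u * v / (A * B) * (m * (P i j * P k l + P i l * P k j)) := by
      simp only [div_eq_mul_inv, mul_inv]
      ring
    rw [e1, e2]
    exact h3
  have hs := Finset.sum_le_sum key
  have er : ∀ a, ∑ l ∈ Finset.univ.erase j, Q a l = 1 - Q a j := by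
    intro a
    rw [← hsum a, ← Finset.add_sum_erase _ _ (Finset.mem_univ j)]
    ring
  rw [← Finset.mul_sum, Finset.sum_sub_distrib, Finset.sum_add_distrib, ← Finset.mul_sum,
    ← Finset.sum_mul, er, er] at hs
  have hb : Q i j * (1 - Q k j) + (1 - Q i j) * Q k j ≤ 1 := by
    nlinarith [mul_nonneg (hnn i j) (hnn k j),
      mul_nonneg (sub_nonneg.2 (hle1 i j)) (sub_nonneg.2 (hle1 k j))]
  have hmb := mul_le_mul_of_nonneg_left hb hm0
  rcases min_cases (Q i j) (Q k j) with h | h <;> rw [h.1]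
  · linarith
  · nlinarith
end

section
/- Let K = 2, let Π be a nonempty finite index set, let P be a 2×2 real matrix with all entries strictly positive, and let f : {1,2} × Π → ℝ be nonnegative with f_{lπ} > 0 for at least one pair (l, π). Define Q_{ij} := (Σ_{π∈Π} P_{ij} f_{jπ}) / (Σ_{l=1}^{2} Σ_{π∈Π} P_{il} f_{lπ}). Then ζ(Q) ≤ |P₁₁ P₂₂ − P₁₂ P₂₁| / (P₁₁ P₂₂ + P₁₂ P₂₁), where ζ(Q) := max_{i,k} (1 − Σ_j min(Q_{ij}, Q_{kj})). -/
/-- In the two-regime case (`K = 2`), `ζ` of the conditional transition matrix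
`Q_{ij} = (Σ_π P_{ij} f_{jπ}) / (Σ_l Σ_π P_{il} f_{lπ})` is bounded by
`|P₁₁P₂₂ − P₁₂P₂₁| / (P₁₁P₂₂ + P₁₂P₂₁)`. -/
theorem zeta_le_of_two_regimes
    {ι : Type*} [Fintype ι] [Nonempty ι]
    (P : Matrix (Fin 2) (Fin 2) ℝ) (hP : ∀ i j, 0 < P i j)
    (f : Fin 2 → ι → ℝ) (hf : ∀ l π, 0 ≤ f l π) (hf' : ∃ l π, 0 < f l π)
    (Q : Matrix (Fin 2) (Fin 2) ℝ)
    (hQ : ∀ i j, Q i j = (∑ π, P i j * f j π) / (∑ l, ∑ π, P i l * f l π)) :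
    zeta Q ≤ |P 0 0 * P 1 1 - P 0 1 * P 1 0| / (P 0 0 * P 1 1 + P 0 1 * P 1 0) := by
  obtain ⟨x, hx⟩ : ∃ x, x = ∑ π, f 0 π := ⟨_, rfl⟩
  obtain ⟨y, hy⟩ : ∃ y, y = ∑ π, f 1 π := ⟨_, rfl⟩
  have hx0 : 0 ≤ x := hx ▸ Finset.sum_nonneg fun π _ => hf 0 π
  have hy0 : 0 ≤ y := hy ▸ Finset.sum_nonneg fun π _ => hf 1 π
  have hxy : 0 < x ∨ 0 < y := by
    obtain ⟨l, π, h⟩ := hf'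
    have key : 0 < ∑ π, f l π :=
      Finset.sum_pos' (fun π _ => hf l π) ⟨π, Finset.mem_univ _, h⟩
    fin_cases l
    · left; rw [hx]; exact key
    · right; rw [hy]; exact key
  have hden : ∀ i, 0 < P i 0 * x + P i 1 * y := by
    intro i
    have h0 := hP i 0
    have h1 := hP i 1
    rcases hxy with h | h
    · have := mul_pos h0 h
      have := mul_nonneg h1.le hy0
      linarith
    · have := mul_pos h1 h
      have := mul_nonneg h0.le hx0
      linarith
  have hQ0 : ∀ i, Q i 0 = P i 0 * x / (P i 0 * x + P i 1 * y) := by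
    intro i
    rw [hQ, Fin.sum_univ_two]
    simp only [← Finset.mul_sum, ← hx, ← hy]
  have hQ1 : ∀ i, Q i 1 = 1 - Q i 0 := by
    intro i
    have := (hden i).ne'
    rw [hQ0, hQ, Fin.sum_univ_two]
    simp only [← Finset.mul_sum, ← hx, ← hy]
    field_simp
    ring
  have hB : 0 < P 0 0 * P 1 1 + P 0 1 * P 1 0 :=
    add_pos (mul_pos (hP _ _) (hP _ _)) (mul_pos (hP _ _) (hP _ _))
  have hD : |Q 0 0 - Q 1 0| ≤
      |P 0 0 * P 1 1 - P 0 1 * P 1 0| / (P 0 0 * P 1 1 + P 0 1 * P 1 0) := by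
    have h0 := hden 0
    have h1 := hden 1
    have e : Q 0 0 - Q 1 0 = (P 0 0 * P 1 1 - P 0 1 * P 1 0) * (x * y) /
        ((P 0 0 * x + P 0 1 * y) * (P 1 0 * x + P 1 1 * y)) := by
      rw [hQ0, hQ0, div_sub_div _ _ h0.ne' h1.ne']
      ring
    rw [e, abs_div, abs_mul, abs_of_pos (mul_pos h0 h1), abs_of_nonneg (mul_nonneg hx0 hy0),
      div_le_div_iff₀ (mul_pos h0 h1) hB, mul_assoc]
    apply mul_le_mul_of_nonneg_left _ (abs_nonneg _)
    have := mul_nonneg (mul_pos (hP 0 0) (hP 1 0)).le (mul_nonneg hx0 hx0)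
    have := mul_nonneg (mul_pos (hP 0 1) (hP 1 1)).le (mul_nonneg hy0 hy0)
    nlinarith
  have hD1 := (abs_le.mp hD).1
  have hD2 := (abs_le.mp hD).2
  have hBn := (abs_nonneg _).trans hD
  unfold zeta
  refine ciSup_le fun i => ciSup_le fun k => ?_
  rw [Fin.sum_univ_two, hQ1, hQ1]
  generalize |P 0 0 * P 1 1 - P 0 1 * P 1 0| / (P 0 0 * P 1 1 + P 0 1 * P 1 0) = B at *
  have hik : Q i 0 - Q k 0 ≤ B ∧ Q k 0 - Q i 0 ≤ B := by
    fin_cases i <;> fin_cases k <;> constructor <;> simp <;> linarith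
  rcases le_total (Q i 0) (Q k 0) with h | h
  · rw [min_eq_left h, min_eq_right (by linarith)]; linarith [hik.2]
  · rw [min_eq_right h, min_eq_left (by linarith)]; linarith [hik.1]
end

section
/- Let d ≥ 1, let x, y ∈ ℝ^d, and let p₁, p₂ > 0. For a d×d real matrix B, define w(B) = p₁ exp(−½‖y − Bᵀx‖₂²) / (p₁ exp(−½‖y − Bᵀx‖₂²) + p₂ exp(−½‖y + Bᵀx‖₂²)). Then w is differentiable at every B, and for every d×d matrix H the derivative of w at B in direction H equals 2 w(B) (1 − w(B)) ⟨y, Hᵀx⟩; equivalently, viewing w as a function of the vectorization β = vec(B) ∈ ℝ^{d²}, the gradient of w with respect to β is 2 w (1 − w) (y ⊗ x), where ⊗ is the Kronecker product of vectors. -/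
/-- Gradient of the filtered probability in the symmetric two-regime mixture of VARs
(Appendix B): with
`w(B) = p₁ exp(−½‖y − Bᵀx‖²) / (p₁ exp(−½‖y − Bᵀx‖²) + p₂ exp(−½‖y + Bᵀx‖²))`,
`w` is differentiable everywhere and its derivative at `B` in direction `H` equals
`2 w(B)(1 − w(B)) ⟨y, Hᵀx⟩`. -/
theorem filtered_probability_gradient (d : ℕ) (hd : 1 ≤ d)
    (x y : Fin d → ℝ) (p₁ p₂ : ℝ) (hp₁ : 0 < p₁) (hp₂ : 0 < p₂)
    (w : (Fin d → Fin d → ℝ) → ℝ)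
    (hw : ∀ B, w B =
      p₁ * Real.exp (-(1 / 2) * ∑ i, (y i - ∑ j, B j i * x j) ^ 2) /
        (p₁ * Real.exp (-(1 / 2) * ∑ i, (y i - ∑ j, B j i * x j) ^ 2) +
          p₂ * Real.exp (-(1 / 2) * ∑ i, (y i + ∑ j, B j i * x j) ^ 2))) :
    ∀ B : Fin d → Fin d → ℝ, DifferentiableAt ℝ w B ∧
      ∀ H : Fin d → Fin d → ℝ,
        fderiv ℝ w B H = 2 * w B * (1 - w B) * ∑ i, y i * ∑ j, H j i * x j := by
  intro B
  have hlin : IsLinearMap ℝ (fun H : Fin d → Fin d → ℝ => ∑ i, y i * ∑ j, H j i * x j) := by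
    constructor
    · intro F G
      simp only [Pi.add_apply, add_mul, Finset.sum_add_distrib, mul_add]
    · intro c F
      simp only [Pi.smul_apply, smul_eq_mul, Finset.mul_sum]
      refine Finset.sum_congr rfl fun i _ => Finset.sum_congr rfl fun j _ => ?_
      ring
  obtain ⟨L, hL⟩ : ∃ L : (Fin d → Fin d → ℝ) →L[ℝ] ℝ,
      ∀ H, L H = ∑ i, y i * ∑ j, H j i * x j :=
    ⟨LinearMap.toContinuousLinearMap (hlin.mk' _), fun H => rfl⟩
  have hw2 : w = fun B => p₁ / (p₁ + p₂ * Real.exp (-2 * L B)) := by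
    funext C
    have hE : -(1 / 2) * ∑ i, (y i + ∑ j, C j i * x j) ^ 2
        = -(1 / 2) * ∑ i, (y i - ∑ j, C j i * x j) ^ 2 + -2 * L C := by
      rw [hL, Finset.mul_sum, Finset.mul_sum, Finset.mul_sum, ← Finset.sum_add_distrib]
      refine Finset.sum_congr rfl fun i _ => ?_
      ring
    rw [hw, hE, Real.exp_add]
    have h1 := Real.exp_pos (-(1 / 2) * ∑ i, (y i - ∑ j, C j i * x j) ^ 2)
    have h2 := Real.exp_pos (-2 * L C)
    generalize Real.exp (-(1 / 2) * ∑ i, (y i - ∑ j, C j i * x j) ^ 2) = a at *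
    generalize Real.exp (-2 * L C) = b at *
    rw [div_eq_div_iff (by positivity) (by positivity)]
    ring
  have hpos : 0 < p₁ + p₂ * Real.exp (-2 * L B) := by positivity
  have hg : HasDerivAt (fun t : ℝ => p₁ / (p₁ + p₂ * Real.exp (-2 * t)))
      ((0 * (p₁ + p₂ * Real.exp (-2 * L B)) - p₁ * (p₂ * (Real.exp (-2 * L B) * (-2 * 1))))
        / (p₁ + p₂ * Real.exp (-2 * L B)) ^ 2) (L B) :=
    (hasDerivAt_const _ p₁).div
      (((((hasDerivAt_id (L B)).const_mul (-2)).exp).const_mul p₂).const_add p₁) hpos.ne'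
  have hf := hg.comp_hasFDerivAt B L.hasFDerivAt
  clear hw
  subst hw2
  refine ⟨hf.differentiableAt, fun H => ?_⟩
  rw [← hL]
  refine (congrArg (fun T : (Fin d → Fin d → ℝ) →L[ℝ] ℝ => T H) hf.fderiv).trans ?_
  simp only [ContinuousLinearMap.smul_apply, smul_eq_mul]
  field_simp
  ring
end
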